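/- Let K ⊂ ℝ^d be a compact convex set with diam(K) ≤ 1, μ a probability measure with supp(μ) ⊂ K, F ⊂ K a closed nonempty set, ε > 0, and x, y, x', y' ∈ K with ‖x − x'‖ ≤ ε and ‖y − y'‖ ≤ ε. Then (i) D_μ([x',y']) ≤ D_μ([x,y]) + β·‖x − y‖·ε + 2ε; and (ii) if moreover x, y ∈ F, then D_μ([x',y']) ≤ D_{μ,F}(x,y) + (β/2)·(‖x − y‖ + 2ε)² + 2ε. Here D_μ([x,y]) = ‖x − y‖ · ∫₀¹ d_μ((1−t)x + ty)^β dt is the FDTM length of the straight segment from x to y. -/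

import Mathlib

open MeasureTheory Metric Set ProbabilityTheory
open scoped ENNReal NNReal

noncomputable section

/-- Euclidean space `ℝ^d`. -/
abbrev Euc (d : ℕ) := EuclideanSpace ℝ (Fin d)

/-- The pseudo-distance-to-measure `δ_{μ,u}(x) = inf {r > 0 : μ(B(x,r)) > u}`. -/
def pseudoDTM {d : ℕ} (μ : Measure (Euc d)) (u : ℝ) (x : Euc d) : ℝ :=
  sInf {r : ℝ | 0 < r ∧ u < (μ (ball x r)).toReal}

/-- The distance-to-measure `d_μ(x) = ((1/m) ∫₀^m δ_{μ,u}(x)^p du)^{1/p}`. -/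
def dtm {d : ℕ} (m p : ℝ) (μ : Measure (Euc d)) (x : Euc d) : ℝ :=
  ((1 / m) * ∫ u in Ioc (0 : ℝ) m, pseudoDTM μ u x ^ p) ^ (1 / p)

/-- A Lipschitz path. -/
def IsLipschitzPath {d : ℕ} (γ : ℝ → Euc d) : Prop := ∃ K, LipschitzWith K γ

/-- Euclidean length `|γ| = ∫₀¹ ‖γ'(t)‖ dt`. -/
def eucLength {d : ℕ} (γ : ℝ → Euc d) : ℝ := ∫ t in Icc (0 : ℝ) 1, ‖deriv γ t‖

/-- FDTM length `D_μ(γ) = ∫₀¹ d_μ(γ(t))^β ‖γ'(t)‖ dt`. -/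
def fdtmLength {d : ℕ} (m p β : ℝ) (μ : Measure (Euc d)) (γ : ℝ → Euc d) : ℝ :=
  ∫ t in Icc (0 : ℝ) 1, dtm m p μ (γ t) ^ β * ‖deriv γ t‖

/-- Admissible paths `Γ_F(x,y)`: Lipschitz paths from `x` to `y` which may leave the domain `F`
only along straight lines. -/
def AdmissiblePath {d : ℕ} (F : Set (Euc d)) (x y : Euc d) (γ : ℝ → Euc d) : Prop :=
  IsLipschitzPath γ ∧ γ 0 = x ∧ γ 1 = y ∧
    ∀ a b : ℝ, 0 ≤ a → b ≤ 1 →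
      (∀ t ∈ Ioo a b, γ t ∉ F) →
      ∃ u : Euc d, ‖u‖ = 1 ∧
        ∀ᵐ t ∂(volume.restrict (Ioo a b)), deriv γ t = ‖deriv γ t‖ • u

/-- The Fermat distance-to-measure `D_{μ,F}(x,y) = inf_{γ ∈ Γ_F(x,y)} D_μ(γ)`. -/
def fdtm {d : ℕ} (m p β : ℝ) (μ : Measure (Euc d)) (F : Set (Euc d)) (x y : Euc d) : ℝ :=
  sInf {L : ℝ | ∃ γ : ℝ → Euc d, AdmissiblePath F x y γ ∧ L = fdtmLength m p β μ γ}

/-- A geodesic: an admissible path realizing the FDTM. -/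
def IsGeodesic {d : ℕ} (m p β : ℝ) (μ : Measure (Euc d)) (F : Set (Euc d)) (x y : Euc d)
    (γ : ℝ → Euc d) : Prop :=
  AdmissiblePath F x y γ ∧ fdtmLength m p β μ γ = fdtm m p β μ F x y

/-- FDTM length of the straight segment `[x,y]`. -/
def segFDTM {d : ℕ} (m p β : ℝ) (μ : Measure (Euc d)) (x y : Euc d) : ℝ :=
  ‖x - y‖ * ∫ t in Icc (0 : ℝ) 1, dtm m p μ ((1 - t) • x + t • y) ^ β

/-- The explicit constant `λ = 2·c·ρ^{β+1}/(ρ−1)` with `c = (16·5^β + 1152·165^β)/m^{2+β}`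
and `ρ = 1 + 32/m`. -/
def fdtmConst (m β : ℝ) : ℝ :=
  2 * ((16 * (5 : ℝ) ^ β + 1152 * (165 : ℝ) ^ β) / m ^ (2 + β)) * (1 + 32 / m) ^ (β + 1) /
    ((1 + 32 / m) - 1)

/-- Support of a measure: points all of whose neighborhoods have positive mass. -/
def measSupport {d : ℕ} (μ : Measure (Euc d)) : Set (Euc d) :=
  {x | ∀ r : ℝ, 0 < r → 0 < μ (ball x r)}

/-- `(a,b)`-standard measure: `μ(B(x,r)) ≥ a·r^b` for `x ∈ supp(μ)` and `0 < r ≤ a^{-1/b}`. -/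
def IsStandard {d : ℕ} (μ : Measure (Euc d)) (a b : ℝ) : Prop :=
  ∀ x ∈ measSupport μ, ∀ r : ℝ, 0 < r → r ≤ a ^ (-(1 / b)) → a * r ^ b ≤ (μ (ball x r)).toReal

theorem integral_rpow_rpow_le_add_const {α : Type*} [MeasurableSpace α] {ν : Measure α}
    [IsProbabilityMeasure ν] {p c : ℝ} (hp : 1 ≤ p) (hc : 0 ≤ c) {f g : α → ℝ}
    (hf0 : 0 ≤ f) (hg0 : 0 ≤ g) (hf : MemLp f (ENNReal.ofReal p) ν)
    (hg : MemLp g (ENNReal.ofReal p) ν) (hfg : ∀ᵐ u ∂ν, f u ≤ g u + c) :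
    (∫ u, f u ^ p ∂ν) ^ (1 / p) ≤ (∫ u, g u ^ p ∂ν) ^ (1 / p) + c := by
  have hp0 : 0 < p := by linarith
  have hP0 : ENNReal.ofReal p ≠ 0 := by simpa using hp0
  have hI : 0 ≤ (∫ u, g u ^ p ∂ν) ^ (1 / p) :=
    Real.rpow_nonneg (integral_nonneg fun u => Real.rpow_nonneg (hg0 u) p) _
  have key : ∀ h : α → ℝ, 0 ≤ h → MemLp h (ENNReal.ofReal p) ν →
      eLpNorm h (ENNReal.ofReal p) ν = ENNReal.ofReal ((∫ u, h u ^ p ∂ν) ^ (1 / p)) := by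
    intro h h0 hh
    rw [hh.eLpNorm_eq_integral_rpow_norm hP0 ENNReal.ofReal_ne_top,
      ENNReal.toReal_ofReal hp0.le, one_div]
    simp only [Real.norm_eq_abs, abs_of_nonneg (h0 _)]
  have h1 : eLpNorm f (ENNReal.ofReal p) ν ≤
      eLpNorm (g + fun _ => c) (ENNReal.ofReal p) ν := by
    refine eLpNorm_mono_ae ?_
    filter_upwards [hfg] with u hu
    simp only [Pi.add_apply, Real.norm_eq_abs]
    rw [abs_of_nonneg (hf0 u)]
    exact hu.trans (le_abs_self _)
  have h2 := h1.trans (eLpNorm_add_le hg.aestronglyMeasurable aestronglyMeasurable_const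
    (by simpa using hp))
  rw [eLpNorm_const c hP0 (IsProbabilityMeasure.ne_zero ν), key f hf0 hf, key g hg0 hg,
    measure_univ, ENNReal.one_rpow, mul_one, Real.enorm_of_nonneg hc,
    ← ENNReal.ofReal_add hI hc] at h2
  exact (ENNReal.ofReal_le_ofReal_iff (add_nonneg hI hc)).1 h2

theorem pseudoDTM_nonneg {d : ℕ} (μ : Measure (Euc d)) (u : ℝ) (x : Euc d) :
    0 ≤ pseudoDTM μ u x :=
  Real.sInf_nonneg fun _ hr => hr.1.le

theorem bddBelow_pseudoDTM {d : ℕ} (μ : Measure (Euc d)) (u : ℝ) (x : Euc d) :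
    BddBelow {r : ℝ | 0 < r ∧ u < (μ (ball x r)).toReal} :=
  ⟨0, fun _ hr => hr.1.le⟩

theorem nonempty_pseudoDTM {d : ℕ} (μ : Measure (Euc d)) [IsProbabilityMeasure μ] {u : ℝ}
    (hu : u < 1) (x : Euc d) : {r : ℝ | 0 < r ∧ u < (μ (ball x r)).toReal}.Nonempty := by
  have hmono : Monotone fun n : ℕ => ball x (n : ℝ) := fun a b hab =>
    ball_subset_ball (by exact_mod_cast hab)
  have h := tendsto_measure_iUnion_atTop (μ := μ) hmono
  rw [iUnion_ball_nat, measure_univ] at h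
  have h' := (ENNReal.tendsto_toReal ENNReal.one_ne_top).comp h
  simp only [ENNReal.toReal_one] at h'
  obtain ⟨n, hn, hn0⟩ := ((h'.eventually (lt_mem_nhds hu)).and
    (Filter.eventually_gt_atTop 0)).exists
  exact ⟨n, by exact_mod_cast hn0, hn⟩

theorem pseudoDTM_le_add_dist {d : ℕ} (μ : Measure (Euc d)) [IsProbabilityMeasure μ] {u : ℝ}
    (hu : u < 1) (x y : Euc d) : pseudoDTM μ u x ≤ pseudoDTM μ u y + dist x y := by
  rw [← sub_le_iff_le_add]
  refine le_csInf (nonempty_pseudoDTM μ hu y) fun r hr => ?_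
  rw [sub_le_iff_le_add]
  refine csInf_le (bddBelow_pseudoDTM μ u x) ⟨by have := hr.1; positivity, hr.2.trans_le ?_⟩
  refine ENNReal.toReal_mono (measure_ne_top _ _) (measure_mono (ball_subset_ball' ?_))
  rw [dist_comm]

theorem pseudoDTM_monotoneOn {d : ℕ} (μ : Measure (Euc d)) [IsProbabilityMeasure μ]
    (x : Euc d) : MonotoneOn (fun u => pseudoDTM μ u x) (Iio 1) := fun a _ _ hb hab =>
  csInf_le_csInf (bddBelow_pseudoDTM μ a x) (nonempty_pseudoDTM μ hb x)
    fun _ hr => ⟨hr.1, hab.trans_lt hr.2⟩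

theorem measure_compl_of_measSupport_subset {d : ℕ} {μ : Measure (Euc d)} {K : Set (Euc d)}
    (h : measSupport μ ⊆ K) : μ Kᶜ = 0 := by
  refine measure_null_of_locally_null _ fun x hx => ?_
  have hx' : x ∉ measSupport μ := fun hxs => hx (h hxs)
  simp only [measSupport, mem_ofPred_eq, not_forall, not_lt, nonpos_iff_eq_zero] at hx'
  obtain ⟨r, hr, h0⟩ := hx'
  exact ⟨ball x r, mem_nhdsWithin_of_mem_nhds (ball_mem_nhds x hr), h0⟩

theorem pseudoDTM_le_one {d : ℕ} {μ : Measure (Euc d)} [IsProbabilityMeasure μ]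
    {K : Set (Euc d)} (hK : Bornology.IsBounded K) (hdiam : diam K ≤ 1)
    (hsupp : measSupport μ ⊆ K) {u : ℝ} (hu : u < 1) {x : Euc d} (hx : x ∈ K) :
    pseudoDTM μ u x ≤ 1 := by
  refine le_of_forall_gt_imp_ge_of_dense fun r hr => ?_
  refine csInf_le (bddBelow_pseudoDTM μ u x) ⟨by linarith, ?_⟩
  have hsub : (ball x r)ᶜ ⊆ Kᶜ := by
    refine compl_subset_compl.2 fun y hy => ?_
    exact (dist_le_diam_of_mem hK hy hx).trans_lt (hdiam.trans_lt hr)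
  have h1 : μ (ball x r) = 1 := (prob_compl_eq_zero_iff measurableSet_ball).1
    (measure_mono_null hsub (measure_compl_of_measSupport_subset hsupp))
  simpa [h1] using hu

/-- The uniform probability measure on `(0, m]`. -/
def uniformIoc (m : ℝ) : Measure ℝ := ENNReal.ofReal (1 / m) • volume.restrict (Ioc 0 m)

theorem isProbabilityMeasure_uniformIoc {m : ℝ} (hm : 0 < m) :
    IsProbabilityMeasure (uniformIoc m) := by
  constructor
  simp only [uniformIoc, Measure.smul_apply, Measure.restrict_apply_univ, Real.volume_Ioc,
    sub_zero, smul_eq_mul]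
  rw [← ENNReal.ofReal_mul (by positivity), one_div_mul_cancel hm.ne', ENNReal.ofReal_one]

theorem ae_uniformIoc {m : ℝ} : ∀ᵐ u ∂(uniformIoc m), u ∈ Ioc 0 m :=
  Measure.ae_smul_measure (ae_restrict_mem measurableSet_Ioc) _

theorem dtm_eq {d : ℕ} {m : ℝ} (hm : 0 < m) (p : ℝ) (μ : Measure (Euc d)) (x : Euc d) :
    dtm m p μ x = (∫ u, pseudoDTM μ u x ^ p ∂(uniformIoc m)) ^ (1 / p) := by
  rw [dtm, uniformIoc, integral_smul_measure, ENNReal.toReal_ofReal (by positivity), smul_eq_mul]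

theorem memLp_pseudoDTM {d : ℕ} {m : ℝ} (hm : m ∈ Ioo (0 : ℝ) 1) (q : ℝ≥0∞)
    (μ : Measure (Euc d)) [IsProbabilityMeasure μ] (x : Euc d) :
    MemLp (fun u => pseudoDTM μ u x) q (uniformIoc m) := by
  have := isProbabilityMeasure_uniformIoc hm.1
  have hmono := pseudoDTM_monotoneOn μ x
  refine MemLp.of_bound (C := pseudoDTM μ m x) ?_ ?_
  · exact ((aemeasurable_restrict_of_monotoneOn measurableSet_Ioc
      (hmono.mono fun u hu => hu.2.trans_lt hm.2)).smul_measure _).aestronglyMeasurable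
  · filter_upwards [ae_uniformIoc] with u hu
    rw [Real.norm_of_nonneg (pseudoDTM_nonneg μ u x)]
    exact hmono (hu.2.trans_lt hm.2) hm.2 hu.2

theorem dtm_nonneg {d : ℕ} {m : ℝ} (hm : 0 < m) (p : ℝ) (μ : Measure (Euc d)) (x : Euc d) :
    0 ≤ dtm m p μ x := by
  rw [dtm_eq hm]
  exact Real.rpow_nonneg (integral_nonneg fun u => Real.rpow_nonneg (pseudoDTM_nonneg μ u x) p) _

theorem lipschitzWith_one_dtm {d : ℕ} {m p : ℝ} (hm : m ∈ Ioo (0 : ℝ) 1) (hp : 1 ≤ p)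
    (μ : Measure (Euc d)) [IsProbabilityMeasure μ] : LipschitzWith 1 (dtm m p μ) := by
  have := isProbabilityMeasure_uniformIoc hm.1
  refine LipschitzWith.of_le_add fun x y => ?_
  rw [dtm_eq hm.1, dtm_eq hm.1]
  refine integral_rpow_rpow_le_add_const hp dist_nonneg (fun u => pseudoDTM_nonneg μ u x)
    (fun u => pseudoDTM_nonneg μ u y) (memLp_pseudoDTM hm _ μ x) (memLp_pseudoDTM hm _ μ y) ?_
  filter_upwards [ae_uniformIoc] with u hu
  exact pseudoDTM_le_add_dist μ (hu.2.trans_lt hm.2) x y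

theorem dtm_le_one {d : ℕ} {m p : ℝ} (hm : m ∈ Ioo (0 : ℝ) 1) (hp : 1 ≤ p)
    {μ : Measure (Euc d)} [IsProbabilityMeasure μ] {K : Set (Euc d)}
    (hK : Bornology.IsBounded K) (hdiam : diam K ≤ 1) (hsupp : measSupport μ ⊆ K) {x : Euc d}
    (hx : x ∈ K) : dtm m p μ x ≤ 1 := by
  have := isProbabilityMeasure_uniformIoc hm.1
  have hp0 : p ≠ 0 := by linarith
  rw [dtm_eq hm.1]
  have h := integral_rpow_rpow_le_add_const (ν := uniformIoc m) (g := 0) hp zero_le_one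
    (fun u => pseudoDTM_nonneg μ u x) le_rfl (memLp_pseudoDTM hm _ μ x) MemLp.zero (by
      filter_upwards [ae_uniformIoc] with u hu
      simpa using pseudoDTM_le_one hK hdiam hsupp (hu.2.trans_lt hm.2) hx)
  simpa [Real.zero_rpow, hp0] using h

theorem rpow_le_rpow_add_mul {a b s β : ℝ} (hβ : 1 ≤ β) (ha0 : 0 ≤ a) (ha1 : a ≤ 1)
    (hb : 0 ≤ b) (hs : 0 ≤ s) (h : a ≤ b + s) : a ^ β ≤ b ^ β + β * s := by
  rcases le_or_gt a b with hab | hab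
  · have := Real.rpow_le_rpow ha0 hab (by linarith : 0 ≤ β)
    nlinarith
  · have hapos : 0 < a := hb.trans_lt hab
    have hB := one_add_mul_self_le_rpow_one_add (s := b / a - 1)
      (by have := div_nonneg hb ha0; linarith) hβ
    rw [add_sub_cancel, Real.div_rpow hb ha0, le_div_iff₀ (Real.rpow_pos_of_pos hapos β)] at hB
    have h1 : a ^ β ≤ a := by
      simpa using Real.rpow_le_rpow_of_exponent_ge hapos ha1 hβ
    have h2 : a ^ β * ((a - b) / a) ≤ a - b := by
      calc a ^ β * ((a - b) / a) ≤ a * ((a - b) / a) := by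
            have : 0 ≤ (a - b) / a := div_nonneg (by linarith) ha0
            gcongr
        _ = a - b := by field_simp
    have h3 : b / a - 1 = -((a - b) / a) := by field_simp; ring
    rw [h3] at hB
    nlinarith

theorem abs_deriv_norm_sub_le {E : Type*} [NormedAddCommGroup E] [NormedSpace ℝ E] {γ : ℝ → E}
    {c : E} {t : ℝ} (hγ : DifferentiableAt ℝ γ t)
    (hr : DifferentiableAt ℝ (fun s => ‖γ s - c‖) t) :
    |deriv (fun s => ‖γ s - c‖) t| ≤ ‖deriv γ t‖ := by
  refine le_of_tendsto_of_tendsto' hr.hasDerivAt.tendsto_slope.abs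
    hγ.hasDerivAt.tendsto_slope.norm fun s => ?_
  simp only [slope, vsub_eq_sub, smul_eq_mul, abs_mul, norm_smul, Real.norm_eq_abs]
  refine mul_le_mul_of_nonneg_left ?_ (abs_nonneg _)
  simpa using abs_norm_sub_norm_le (γ s - c) (γ t - c)

theorem intervalIntegrable_mul_norm_deriv {E : Type*} [NormedAddCommGroup E] [NormedSpace ℝ E]
    [CompleteSpace E] [MeasurableSpace E] [BorelSpace E] [SecondCountableTopology E]
    {C : ℝ≥0} {γ : ℝ → E}
    (hγ : LipschitzWith C γ) {f : ℝ → ℝ} (hf : Continuous f) (a b : ℝ) :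
    IntervalIntegrable (fun t => f t * ‖deriv γ t‖) volume a b := by
  refine IntervalIntegrable.continuousOn_mul ?_ hf.continuousOn
  refine (intervalIntegrable_const (c := (C : ℝ))).mono_fun
    (measurable_deriv γ).norm.aestronglyMeasurable (Filter.Eventually.of_forall fun t => ?_)
  simpa using norm_deriv_le_of_lipschitz hγ

theorem abs_integral_norm_sub_le {E : Type*} [NormedAddCommGroup E] [NormedSpace ℝ E]
    [FiniteDimensional ℝ E] [MeasurableSpace E] [BorelSpace E] {C B : ℝ≥0} {γ : ℝ → E}
    (hγ : LipschitzWith C γ) (c : E) {g f : ℝ → ℝ} (hg : Continuous g) (hg0 : ∀ r, 0 ≤ g r)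
    (hgB : ∀ r, g r ≤ B) (hf : Continuous f) (hgf : ∀ t, g ‖γ t - c‖ ≤ f t) {a b : ℝ}
    (hab : a ≤ b) :
    |∫ r in ‖γ a - c‖..‖γ b - c‖, g r| ≤ ∫ t in a..b, f t * ‖deriv γ t‖ := by
  have := FiniteDimensional.complete ℝ E
  have := FiniteDimensional.proper ℝ E
  set ρ : ℝ → ℝ := fun t => ‖γ t - c‖ with hρ
  set G : ℝ → ℝ := fun r => ∫ s in (0 : ℝ)..r, g s with hG
  have hGd : ∀ r, HasDerivAt G (g r) r := fun r => hg.integral_hasStrictDerivAt 0 r |>.hasDerivAt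
  have hGL : LipschitzWith B G := lipschitzWith_of_nnnorm_deriv_le
    (fun r => (hGd r).differentiableAt) fun r => by
      rw [(hGd r).deriv, ← NNReal.coe_le_coe, coe_nnnorm, Real.norm_of_nonneg (hg0 r)]
      exact hgB r
  have hρL : LipschitzWith C ρ := by
    refine LipschitzWith.of_dist_le_mul fun s t => ?_
    refine le_trans ?_ (hγ.dist_le_mul s t)
    rw [Real.dist_eq, dist_eq_norm]
    simpa [hρ] using abs_norm_sub_norm_le (γ s - c) (γ t - c)
  have hac : AbsolutelyContinuousOnInterval (G ∘ ρ) a b :=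
    (hGL.comp hρL).lipschitzOnWith.absolutelyContinuousOnInterval
  have hint : ∫ r in ρ a..ρ b, g r = ∫ t in a..b, deriv (G ∘ ρ) t := by
    rw [hac.integral_deriv_eq_sub, Function.comp, Function.comp,
      intervalIntegral.integral_interval_sub_left (hg.intervalIntegrable _ _)
        (hg.intervalIntegrable _ _)]
  rw [hint, ← Real.norm_eq_abs]
  refine intervalIntegral.norm_integral_le_of_norm_le hab ?_
    (intervalIntegrable_mul_norm_deriv hγ hf a b)
  filter_upwards [hγ.ae_differentiableAt_real, hρL.ae_differentiableAt_real] with t h1 h2 _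
  rw [((hGd (ρ t)).comp t h2.hasDerivAt).deriv, norm_mul, Real.norm_of_nonneg (hg0 _)]
  exact mul_le_mul (hgf t) (abs_deriv_norm_sub_le h1 h2) (norm_nonneg _) ((hg0 _).trans (hgf t))

/-- The lower bound for `D ^ β` at distance `|r|` from a point where the `1`-Lipschitz function
`D` takes the value `a`. -/
def coneRpow (β a r : ℝ) : ℝ := max 0 (a - |r|) ^ β

theorem continuous_coneRpow {β : ℝ} (hβ : 1 ≤ β) (a : ℝ) : Continuous (coneRpow β a) := by
  unfold coneRpow
  exact (by fun_prop : Continuous fun r : ℝ => max 0 (a - |r|)).rpow_const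
    fun _ => Or.inr (by linarith)

theorem coneRpow_nonneg (β a r : ℝ) : 0 ≤ coneRpow β a r :=
  Real.rpow_nonneg (le_max_left _ _) _

theorem coneRpow_le {β a : ℝ} (hβ : 1 ≤ β) (ha : 0 ≤ a) (r : ℝ) : coneRpow β a r ≤ a ^ β :=
  Real.rpow_le_rpow (le_max_left _ _) (max_le ha (by linarith [abs_nonneg r])) (by linarith)

theorem coneRpow_norm_sub_le {E : Type*} [NormedAddCommGroup E] {D : E → ℝ}
    (hD : LipschitzWith 1 D) (hD0 : ∀ z, 0 ≤ D z) {β : ℝ} (hβ : 1 ≤ β) (c w : E) :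
    coneRpow β (D c) ‖w - c‖ ≤ D w ^ β := by
  refine Real.rpow_le_rpow (le_max_left _ _) (max_le (hD0 w) ?_) (by linarith)
  have := hD.le_add_mul c w
  rw [dist_comm, dist_eq_norm] at this
  simp at this ⊢
  linarith

theorem rpow_le_coneRpow_add {E : Type*} [NormedAddCommGroup E] {D : E → ℝ}
    (hD : LipschitzWith 1 D) (hD0 : ∀ z, 0 ≤ D z) {β : ℝ} (hβ : 1 ≤ β) (c w : E)
    (hw : D w ≤ 1) : D w ^ β ≤ coneRpow β (D c) ‖w - c‖ + β * (2 * ‖w - c‖) := by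
  refine rpow_le_rpow_add_mul hβ (hD0 w) hw (le_max_left _ _) (by positivity) ?_
  have := hD.le_add_mul w c
  rw [dist_eq_norm] at this
  simp only [NNReal.coe_one, one_mul, abs_norm] at this ⊢
  linarith [le_max_right 0 (D c - ‖w - c‖)]

theorem norm_sub_mul_integral_half_segment_le {E : Type*} [NormedAddCommGroup E]
    [NormedSpace ℝ E] {D : E → ℝ} (hD : LipschitzWith 1 D) (hD0 : ∀ z, 0 ≤ D z) {β : ℝ}
    (hβ : 1 ≤ β) (c e : E) (h1 : ∀ t ∈ Icc (0 : ℝ) 1, D ((1 - t) • c + t • e) ≤ 1) :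
    ‖c - e‖ * ∫ t in (0 : ℝ)..(1 / 2), D ((1 - t) • c + t • e) ^ β ≤
      (∫ r in (0 : ℝ)..(‖c - e‖ / 2), coneRpow β (D c) r) + β / 4 * ‖c - e‖ ^ 2 := by
  set L := ‖c - e‖ with hL
  have hcont : Continuous fun t : ℝ => D ((1 - t) • c + t • e) ^ β :=
    (hD.continuous.comp (by fun_prop)).rpow_const fun _ => Or.inr (by linarith)
  have hc : Continuous fun t : ℝ => coneRpow β (D c) (L * t) :=
    (continuous_coneRpow hβ _).comp (by fun_prop)
  have hl : Continuous fun t : ℝ => (2 * β * L) * t := by fun_prop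
  have hle : ∫ t in (0 : ℝ)..(1 / 2), D ((1 - t) • c + t • e) ^ β ≤
      ∫ t in (0 : ℝ)..(1 / 2), (coneRpow β (D c) (L * t) + (2 * β * L) * t) := by
    refine intervalIntegral.integral_mono_on (by norm_num) (hcont.intervalIntegrable _ _)
      ((hc.add hl).intervalIntegrable _ _) fun t ht => ?_
    have hn : ‖(1 - t) • c + t • e - c‖ = L * t := by
      have : (1 - t) • c + t • e - c = -(t • (c - e)) := by module
      rw [this, norm_neg, norm_smul, Real.norm_of_nonneg ht.1, mul_comm]
    have := rpow_le_coneRpow_add hD hD0 hβ c _ (h1 t ⟨ht.1, by linarith [ht.2]⟩)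
    rw [hn] at this
    linarith
  rw [intervalIntegral.integral_add (hc.intervalIntegrable _ _) (hl.intervalIntegrable _ _),
    intervalIntegral.integral_const_mul, integral_id] at hle
  have := mul_le_mul_of_nonneg_left hle (norm_nonneg (c - e))
  rw [← hL, mul_add, intervalIntegral.mul_integral_comp_mul_left, mul_zero, mul_one_div] at this
  linarith

theorem integral_cone_le {d : ℕ} {D : Euc d → ℝ} (hD : LipschitzWith 1 D) (hD0 : ∀ z, 0 ≤ D z)
    {β : ℝ} (hβ : 1 ≤ β) {γ : ℝ → Euc d} (hγ : IsLipschitzPath γ) (c : Euc d) {a b R : ℝ}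
    (hab : a ≤ b) (hR : 0 ≤ R)
    (h : γ a = c ∧ R ≤ ‖γ b - c‖ ∨ γ b = c ∧ R ≤ ‖γ a - c‖) :
    ∫ r in (0 : ℝ)..R, coneRpow β (D c) r ≤ ∫ t in a..b, D (γ t) ^ β * ‖deriv γ t‖ := by
  obtain ⟨C, hC⟩ := hγ
  have hg := continuous_coneRpow hβ (D c)
  have hmain := abs_integral_norm_sub_le (B := ⟨D c ^ β, Real.rpow_nonneg (hD0 c) β⟩) hC c hg
    (coneRpow_nonneg β (D c)) (coneRpow_le hβ (hD0 c))
    ((hD.continuous.comp hC.continuous).rpow_const fun _ => Or.inr (by linarith))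
    (fun t => coneRpow_norm_sub_le hD hD0 hβ c (γ t)) hab
  have hmono : ∀ R' : ℝ, R ≤ R' → ∫ r in (0 : ℝ)..R, coneRpow β (D c) r ≤
      |∫ r in (0 : ℝ)..R', coneRpow β (D c) r| := fun R' hR' =>
    (intervalIntegral.integral_mono_interval le_rfl hR hR'
      (Filter.Eventually.of_forall fun r => coneRpow_nonneg β (D c) r)
      (hg.intervalIntegrable _ _)).trans (le_abs_self _)
  refine le_trans ?_ hmain
  rcases h with ⟨h0, hR'⟩ | ⟨h0, hR'⟩
  · simpa [h0] using hmono _ hR'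
  · rw [intervalIntegral.integral_symm ‖γ b - c‖, abs_neg]
    simpa [h0] using hmono _ hR'

theorem segment_le_path {d : ℕ} {D : Euc d → ℝ} (hD : LipschitzWith 1 D) (hD0 : ∀ z, 0 ≤ D z)
    {β : ℝ} (hβ : 1 ≤ β) {γ : ℝ → Euc d} (hγ : IsLipschitzPath γ)
    (h1 : ∀ t ∈ Icc (0 : ℝ) 1, D ((1 - t) • γ 0 + t • γ 1) ≤ 1) :
    ‖γ 0 - γ 1‖ * ∫ t in Icc (0 : ℝ) 1, D ((1 - t) • γ 0 + t • γ 1) ^ β ≤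
      (∫ t in Icc (0 : ℝ) 1, D (γ t) ^ β * ‖deriv γ t‖) + β / 2 * ‖γ 0 - γ 1‖ ^ 2 := by
  have hγc : Continuous γ := hγ.choose_spec.continuous
  have hβ0 : 0 ≤ β := by linarith
  obtain ⟨s, hs, heq⟩ : ∃ s ∈ Icc (0 : ℝ) 1, ‖γ s - γ 0‖ - ‖γ s - γ 1‖ = 0 := by
    refine intermediate_value_Icc (f := fun s => ‖γ s - γ 0‖ - ‖γ s - γ 1‖) zero_le_one
      (by fun_prop) ⟨?_, ?_⟩ <;> simp
  have htri : ‖γ 0 - γ 1‖ ≤ ‖γ s - γ 0‖ + ‖γ s - γ 1‖ := by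
    rw [norm_sub_rev (γ s) (γ 0)]
    exact norm_sub_le_norm_sub_add_norm_sub _ _ _
  have hL0 : 0 ≤ ‖γ 0 - γ 1‖ / 2 := by positivity
  have hx := integral_cone_le hD hD0 hβ hγ (γ 0) hs.1 hL0 (Or.inl ⟨rfl, by linarith⟩)
  have hy := integral_cone_le hD hD0 hβ hγ (γ 1) hs.2 hL0 (Or.inr ⟨rfl, by linarith⟩)
  have hint : ∀ a b, IntervalIntegrable (fun t => D (γ t) ^ β * ‖deriv γ t‖) volume a b :=
    intervalIntegrable_mul_norm_deriv hγ.choose_spec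
      ((hD.continuous.comp hγc).rpow_const fun _ => Or.inr hβ0)
  have hcont : Continuous fun t : ℝ => D ((1 - t) • γ 0 + t • γ 1) ^ β :=
    (hD.continuous.comp (by fun_prop)).rpow_const fun _ => Or.inr hβ0
  have hsx := norm_sub_mul_integral_half_segment_le hD hD0 hβ (γ 0) (γ 1) h1
  have hsy := norm_sub_mul_integral_half_segment_le hD hD0 hβ (γ 1) (γ 0) fun t ht => by
    have := h1 (1 - t) ⟨by linarith [ht.2], by linarith [ht.1]⟩
    rwa [sub_sub_cancel, add_comm] at this
  have hrev : ∫ t in (0 : ℝ)..(1 / 2), D ((1 - t) • γ 1 + t • γ 0) ^ β =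
      ∫ t in (1 / 2 : ℝ)..1, D ((1 - t) • γ 0 + t • γ 1) ^ β := by
    have := intervalIntegral.integral_comp_sub_left (a := 0) (b := 1 / 2)
      (fun t : ℝ => D ((1 - t) • γ 0 + t • γ 1) ^ β) 1
    norm_num at this ⊢
    rw [← this]
    simp only [add_comm]
  rw [hrev, norm_sub_rev] at hsy
  rw [integral_Icc_eq_integral_Ioc, integral_Icc_eq_integral_Ioc,
    ← intervalIntegral.integral_of_le zero_le_one, ← intervalIntegral.integral_of_le zero_le_one,
    ← intervalIntegral.integral_add_adjacent_intervals (hint 0 s) (hint s 1),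
    ← intervalIntegral.integral_add_adjacent_intervals (hcont.intervalIntegrable 0 (1 / 2))
      (hcont.intervalIntegrable (1 / 2) 1)]
  linarith

theorem segment_perturb_le {E : Type*} [NormedAddCommGroup E] [NormedSpace ℝ E] {D : E → ℝ}
    (hD : LipschitzWith 1 D) (hD0 : ∀ z, 0 ≤ D z) {β ε : ℝ} (hβ : 1 ≤ β) {x y x' y' : E}
    (h1 : ∀ t ∈ Icc (0 : ℝ) 1, D ((1 - t) • x' + t • y') ≤ 1)
    (hx : ‖x - x'‖ ≤ ε) (hy : ‖y - y'‖ ≤ ε) :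
    ‖x' - y'‖ * ∫ t in Icc (0 : ℝ) 1, D ((1 - t) • x' + t • y') ^ β ≤
      ‖x - y‖ * (∫ t in Icc (0 : ℝ) 1, D ((1 - t) • x + t • y) ^ β) + β * ‖x - y‖ * ε +
        2 * ε := by
  have hβ0 : 0 ≤ β := by linarith
  have hε : 0 ≤ ε := (norm_nonneg _).trans hx
  have hcont : ∀ x y : E, Continuous fun t : ℝ => D ((1 - t) • x + t • y) ^ β := fun x y =>
    (hD.continuous.comp (by fun_prop)).rpow_const fun _ => Or.inr hβ0
  simp only [integral_Icc_eq_integral_Ioc,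
    ← intervalIntegral.integral_of_le (zero_le_one : (0 : ℝ) ≤ 1)]
  have hclose : ∫ t in (0 : ℝ)..1, D ((1 - t) • x' + t • y') ^ β ≤
      (∫ t in (0 : ℝ)..1, D ((1 - t) • x + t • y) ^ β) + β * ε := by
    have : ∫ t in (0 : ℝ)..1, D ((1 - t) • x' + t • y') ^ β ≤
        ∫ t in (0 : ℝ)..1, (D ((1 - t) • x + t • y) ^ β + β * ε) := by
      refine intervalIntegral.integral_mono_on zero_le_one ((hcont _ _).intervalIntegrable _ _)
        (((hcont _ _).add continuous_const).intervalIntegrable _ _) fun t ht => ?_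
      refine rpow_le_rpow_add_mul hβ (hD0 _) (h1 t ht) (hD0 _) hε ?_
      have hl := hD.le_add_mul ((1 - t) • x' + t • y') ((1 - t) • x + t • y)
      have hd : dist ((1 - t) • x' + t • y') ((1 - t) • x + t • y) ≤ ε := by
        have : (1 - t) • x + t • y - ((1 - t) • x' + t • y') =
          (1 - t) • (x - x') + t • (y - y') := by module
        rw [dist_comm, dist_eq_norm, this]
        refine (norm_add_le _ _).trans ?_
        rw [norm_smul, norm_smul, Real.norm_of_nonneg ht.1,
          Real.norm_of_nonneg (sub_nonneg.2 ht.2)]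
        nlinarith [ht.1, ht.2]
      simp only [NNReal.coe_one, one_mul] at hl
      linarith
    rw [intervalIntegral.integral_add ((hcont _ _).intervalIntegrable _ _)
      (continuous_const.intervalIntegrable _ _)] at this
    simpa using this
  have hle1 : ∫ t in (0 : ℝ)..1, D ((1 - t) • x' + t • y') ^ β ≤ 1 := by
    have := intervalIntegral.integral_mono_on (μ := volume) zero_le_one
      ((hcont x' y').intervalIntegrable 0 1)
      ((continuous_const (y := (1 : ℝ))).intervalIntegrable 0 1)
      fun t ht => Real.rpow_le_one (hD0 _) (h1 t ht) hβ0
    simpa using this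
  have hnonneg : 0 ≤ ∫ t in (0 : ℝ)..1, D ((1 - t) • x' + t • y') ^ β :=
    intervalIntegral.integral_nonneg zero_le_one fun t _ => Real.rpow_nonneg (hD0 _) _
  have hnorm : ‖x' - y'‖ ≤ ‖x - y‖ + 2 * ε := by
    have h2 : x' - y' = (x - y) - (x - x') + (y - y') := by abel
    rw [h2]
    linarith [norm_add_le ((x - y) - (x - x')) (y - y'), norm_sub_le (x - y) (x - x')]
  calc _ ≤ (‖x - y‖ + 2 * ε) * ∫ t in (0 : ℝ)..1, D ((1 - t) • x' + t • y') ^ β := by gcongr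
    _ ≤ _ := by nlinarith [norm_nonneg (x - y)]

theorem admissiblePath_segment {d : ℕ} (F : Set (Euc d)) {x y : Euc d} (hxy : x ≠ y) :
    AdmissiblePath F x y fun t : ℝ => (1 - t) • x + t • y := by
  have hfun : (fun t : ℝ => (1 - t) • x + t • y) = fun t : ℝ => t • (y - x) + x := by
    funext t; module
  have hd : ∀ t : ℝ, HasDerivAt (fun t : ℝ => (1 - t) • x + t • y) (y - x) t := fun t => by
    rw [hfun]
    simpa using ((hasDerivAt_id t).smul_const (y - x)).add_const x
  have hn : ‖y - x‖ ≠ 0 := norm_ne_zero_iff.2 (sub_ne_zero.2 hxy.symm)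
  refine ⟨⟨‖y - x‖₊, lipschitzWith_of_nnnorm_deriv_le (fun t => (hd t).differentiableAt)
    fun t => by rw [(hd t).deriv]⟩, by simp, by simp, fun a b _ _ _ =>
    ⟨‖y - x‖⁻¹ • (y - x), ?_, Filter.Eventually.of_forall fun t => ?_⟩⟩
  · rw [norm_smul, norm_inv, norm_norm, inv_mul_cancel₀ hn]
  · rw [(hd t).deriv, smul_smul, mul_inv_cancel₀ hn, one_smul]

theorem segFDTM_perturbed_bounds {d : ℕ} (m p β : ℝ) (hm : m ∈ Set.Ioo (0 : ℝ) 1) (hp : 1 ≤ p)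
    (hβ : 1 ≤ β) (K : Set (Euc d)) (hKc : IsCompact K) (hKconv : Convex ℝ K)
    (hKdiam : diam K ≤ 1)
    (μ : Measure (Euc d)) [IsProbabilityMeasure μ] (hsupp : measSupport μ ⊆ K)
    (F : Set (Euc d)) (hFK : F ⊆ K) (hF : IsClosed F) (hFne : F.Nonempty)
    (ε : ℝ) (hε : 0 < ε) (x y x' y' : Euc d)
    (hx : x ∈ K) (hy : y ∈ K) (hx' : x' ∈ K) (hy' : y' ∈ K)
    (hxx' : ‖x - x'‖ ≤ ε) (hyy' : ‖y - y'‖ ≤ ε) :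
    (segFDTM m p β μ x' y' ≤ segFDTM m p β μ x y + β * ‖x - y‖ * ε + 2 * ε) ∧
    (x ∈ F → y ∈ F →
      segFDTM m p β μ x' y' ≤ fdtm m p β μ F x y + (β / 2) * (‖x - y‖ + 2 * ε) ^ 2 + 2 * ε) := by
  have hD := lipschitzWith_one_dtm hm hp μ
  have hD0 := dtm_nonneg hm.1 p μ
  have hle : ∀ a ∈ K, ∀ b ∈ K, ∀ t ∈ Icc (0 : ℝ) 1, dtm m p μ ((1 - t) • a + t • b) ≤ 1 :=
    fun a ha b hb t ht => dtm_le_one hm hp hKc.isBounded hKdiam hsupp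
      (hKconv ha hb (sub_nonneg.2 ht.2) ht.1 (sub_add_cancel 1 t))
  have hseg : segFDTM m p β μ x' y' ≤ segFDTM m p β μ x y + β * ‖x - y‖ * ε + 2 * ε :=
    segment_perturb_le hD hD0 hβ (hle x' hx' y' hy') hxx' hyy'
  refine ⟨hseg, fun _ _ => ?_⟩
  suffices h : segFDTM m p β μ x y ≤ fdtm m p β μ F x y + β / 2 * ‖x - y‖ ^ 2 by
    have : 0 ≤ β * ‖x - y‖ * ε := by positivity
    have : 0 ≤ β * ε ^ 2 := by positivity
    linarith
  rcases eq_or_ne x y with rfl | hxy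
  · have : 0 ≤ fdtm m p β μ F x x := by
      refine Real.sInf_nonneg ?_
      rintro L ⟨γ, -, rfl⟩
      exact integral_nonneg fun t => mul_nonneg (Real.rpow_nonneg (hD0 _) _) (norm_nonneg _)
    simpa [segFDTM] using this
  · rw [← sub_le_iff_le_add]
    refine le_csInf ⟨_, _, admissiblePath_segment F hxy, rfl⟩ ?_
    rintro L ⟨γ, ⟨hγ, rfl, rfl, -⟩, rfl⟩
    rw [sub_le_iff_le_add]
    exact segment_le_path hD hD0 hβ hγ (hle _ hx _ hy)

end
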